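/- Let σ1², σ2², σ_Y² > 0, x1, x2, y1 ∈ ℝ^p, and A ⊆ ℝ^p measurable. Writing φ_v for the density of N_p(0, v I_p), the following Gaussian integral identity holds: ∫_{ℝ^p}∫_{ℝ^p} φ_{σ_Y²}(y1 − θ1) φ_{σ1²}(θ1 − x1) φ_{σ2²}(θ2 − x2) 1_A(θ1 − θ2) dθ1 dθ2 = φ_{σ1²+σ_Y²}(y1 − x1) · P(T ∈ A), where T ~ N_p( β(y1 − x1) + (x1 − x2), σ_T² I_p ) with β = σ1²/(σ1² + σ_Y²) and σ_T² = σ1²σ_Y²/(σ1² + σ_Y²) + σ2². (This gives the representation of the Kullback–Leibler Bayes predictive density under the uniform prior 1_A(θ1 − θ2) as q̂(y1; x) = φ_{σ1²+σ_Y²}(y1 − x1)·P(T ∈ A)/P(Z1 ∈ A) with Z1 ~ N_p(x1 − x2, (σ1²+σ2²) I_p).) -/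

import Mathlib

open MeasureTheory Real Set

noncomputable section

abbrev Ep (p : ℕ) := EuclideanSpace ℝ (Fin p)

/-- Density of `N_p(0, v I_p)` evaluated at `u`. -/
def gdens (p : ℕ) (v : ℝ) (u : Ep p) : ℝ :=
  (2 * Real.pi * v) ^ (-(p : ℝ) / 2) * Real.exp (-‖u‖ ^ 2 / (2 * v))

theorem gdens_neg (p : ℕ) (v : ℝ) (u : Ep p) : gdens p v (-u) = gdens p v u := by
  simp [gdens]

theorem gdens_sub_comm (p : ℕ) (v : ℝ) (u w : Ep p) :
    gdens p v (u - w) = gdens p v (w - u) := by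
  rw [← gdens_neg, neg_sub]

theorem integral_gdens (p : ℕ) {v : ℝ} (hv : 0 < v) : ∫ u : Ep p, gdens p v u = 1 := by
  have h := GaussianFourier.integral_rexp_neg_mul_sq_norm (V := Ep p)
    (b := 1 / (2 * v)) (by positivity)
  have hexp : ∀ u : Ep p, -‖u‖ ^ 2 / (2 * v) = -(1 / (2 * v)) * ‖u‖ ^ 2 := fun u => by ring
  have hbase : π / (1 / (2 * v)) = 2 * π * v := by field_simp
  simp only [gdens, hexp]
  rw [integral_const_mul, h, hbase, finrank_euclideanSpace_fin, ← Real.rpow_add (by positivity)]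
  rw [show -(p : ℝ) / 2 + (p : ℝ) / 2 = 0 by ring, Real.rpow_zero]

theorem integrable_gdens (p : ℕ) {v : ℝ} (hv : 0 < v) : Integrable (gdens p v) :=
  .of_integral_ne_zero (by rw [integral_gdens p hv]; exact one_ne_zero)

/-- Completing the square in a product of two isotropic Gaussian densities. -/
theorem gdens_mul_gdens (p : ℕ) {a b : ℝ} (ha : 0 < a) (hb : 0 < b) (x y z : Ep p) :
    gdens p a (y - z) * gdens p b (z - x) =
      gdens p (a + b) (y - x) *
        gdens p (b * a / (b + a)) (z - (x + (b / (b + a)) • (y - x))) := by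
  have hconst : (2 * π * a) ^ (-(p : ℝ) / 2) * (2 * π * b) ^ (-(p : ℝ) / 2) =
      (2 * π * (a + b)) ^ (-(p : ℝ) / 2) * (2 * π * (b * a / (b + a))) ^ (-(p : ℝ) / 2) := by
    rw [← Real.mul_rpow (by positivity) (by positivity),
      ← Real.mul_rpow (by positivity) (by positivity)]
    congr 1
    field_simp
    ring
  have hexp : -‖y - z‖ ^ 2 / (2 * a) + -‖z - x‖ ^ 2 / (2 * b) =
      -‖y - x‖ ^ 2 / (2 * (a + b)) +
        -‖z - (x + (b / (b + a)) • (y - x))‖ ^ 2 / (2 * (b * a / (b + a))) := by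
    rw [← sub_sub z x, ← sub_sub_sub_cancel_right y z x, norm_sub_sq_real (y - x),
      norm_sub_sq_real (z - x), inner_smul_right, norm_smul, mul_pow, Real.norm_eq_abs, sq_abs,
      real_inner_comm (z - x) (y - x)]
    field_simp
    ring
  simp only [gdens]
  rw [mul_mul_mul_comm, ← Real.exp_add, hexp, hconst, Real.exp_add, mul_mul_mul_comm]

/-- The convolution of two isotropic Gaussian densities is Gaussian. -/
theorem integral_gdens_mul_gdens (p : ℕ) {a b : ℝ} (ha : 0 < a) (hb : 0 < b) (x y : Ep p) :
    ∫ z, gdens p a (y - z) * gdens p b (z - x) = gdens p (a + b) (y - x) := by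
  simp only [gdens_mul_gdens p ha hb]
  rw [integral_const_mul, integral_sub_right_eq_self (gdens p (b * a / (b + a))),
    integral_gdens p (by positivity), mul_one]

/-- If `Z ~ N_p(m, a I_p)` and `W ~ N_p(x, b I_p)` are independent, then the probability of
`Z - W ∈ A` is that of `N_p(m - x, (a + b) I_p)`. -/
theorem integral_integral_gdens_mul_indicator_sub (p : ℕ) {a b : ℝ} (ha : 0 < a) (hb : 0 < b)
    (m x : Ep p) {A : Set (Ep p)} (hA : MeasurableSet A) :
    (∫ z : Ep p, ∫ w : Ep p, gdens p a (z - m) * gdens p b (w - x) *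
        A.indicator (fun _ => (1 : ℝ)) (z - w)) =
      ∫ t in A, gdens p (a + b) (t - (m - x)) := by
  have hshift : ∀ z : Ep p, (∫ w : Ep p, gdens p a (z - m) * gdens p b (w - x) *
        A.indicator (fun _ => (1 : ℝ)) (z - w)) =
      ∫ t : Ep p, A.indicator (fun t => gdens p b ((t + x) - z) * gdens p a (z - m)) t := by
    intro z
    rw [← integral_sub_left_eq_self _ volume z]
    refine integral_congr_ae (.of_forall fun t => ?_)
    have ht : gdens p b (z - t - x) = gdens p b ((t + x) - z) := by
      rw [gdens_sub_comm]
      congr 1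
      abel
    by_cases h : t ∈ A
    · simp [h, ht, mul_comm]
    · simp [h]
  have hint : Integrable (fun q : Ep p × Ep p =>
      gdens p b ((q.1 + x) - q.2) * gdens p a (q.2 - m)) (volume.prod volume) := by
    refine (Integrable.convolution_integrand (ContinuousLinearMap.mul ℝ ℝ)
      ((integrable_gdens p ha).comp_sub_right m)
      ((integrable_gdens p hb).comp_add_right x)).congr (.of_forall fun q => ?_)
    simp only [ContinuousLinearMap.mul_apply']
    rw [mul_comm, sub_add_eq_add_sub]
  simp only [hshift]
  rw [← integral_integral_swap, ← integral_indicator hA]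
  · refine integral_congr_ae (.of_forall fun t => ?_)
    by_cases h : t ∈ A
    · simp only [indicator_of_mem h]
      rw [integral_gdens_mul_gdens p hb ha, add_comm b a]
      congr 1
      abel
    · simp [h]
  · refine (hint.indicator (measurable_fst hA)).congr (.of_forall fun q => ?_)
    rfl

/-- Gaussian integral identity underlying the representation of the Kullback–Leibler
Bayes predictive density under the uniform prior `1_A(θ1 - θ2)`:
`∫∫ φ_{σY²}(y1-θ1) φ_{σ1²}(θ1-x1) φ_{σ2²}(θ2-x2) 1_A(θ1-θ2) dθ1 dθ2
  = φ_{σ1²+σY²}(y1-x1) · P(T ∈ A)`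
with `T ~ N_p(β(y1-x1)+(x1-x2), σ_T² I)`, `β = σ1²/(σ1²+σY²)`,
`σ_T² = σ1²σY²/(σ1²+σY²) + σ2²`. -/
theorem stmt10 (p : ℕ) (σ12 σ22 σY2 : ℝ)
    (hσ1 : 0 < σ12) (hσ2 : 0 < σ22) (hσY : 0 < σY2)
    (x1 x2 y1 : Ep p) (A : Set (Ep p)) (hA : MeasurableSet A)
    (β σT2 : ℝ) (hβ : β = σ12 / (σ12 + σY2))
    (hσT : σT2 = σ12 * σY2 / (σ12 + σY2) + σ22) :
    (∫ θ1 : Ep p, ∫ θ2 : Ep p,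
        gdens p σY2 (y1 - θ1) * gdens p σ12 (θ1 - x1) * gdens p σ22 (θ2 - x2) *
          Set.indicator A (fun _ => (1 : ℝ)) (θ1 - θ2)) =
      gdens p (σ12 + σY2) (y1 - x1) *
        ∫ t in A, gdens p σT2 (t - (β • (y1 - x1) + (x1 - x2))) := by
  have hsplit : ∀ θ1 θ2 : Ep p,
      gdens p σY2 (y1 - θ1) * gdens p σ12 (θ1 - x1) * gdens p σ22 (θ2 - x2) *
          Set.indicator A (fun _ => (1 : ℝ)) (θ1 - θ2) =
        gdens p (σ12 + σY2) (y1 - x1) *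
          (gdens p (σ12 * σY2 / (σ12 + σY2)) (θ1 - (x1 + β • (y1 - x1))) *
            gdens p σ22 (θ2 - x2) * Set.indicator A (fun _ => (1 : ℝ)) (θ1 - θ2)) := by
    intro θ1 θ2
    rw [gdens_mul_gdens p hσY hσ1, hβ, add_comm σY2 σ12]
    ring
  simp only [hsplit, integral_const_mul]
  rw [integral_integral_gdens_mul_indicator_sub p (by positivity) hσ2 _ _ hA, ← hσT,
    show x1 + β • (y1 - x1) - x2 = β • (y1 - x1) + (x1 - x2) by abel]

end
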